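/- Let m ∈ ℕ and let I : (0,∞) → (0,∞) be non-decreasing. If for some non-negative measurable f on (0,∞) there exists t₀ ∈ (0,∞) with R_I^m f*(t₀) = ∞, then R_I^m f*(t) = ∞ for all t ∈ (0,∞). -/

import Mathlib

open MeasureTheory Set Filter
open scoped ENNReal NNReal Topology

noncomputable section

/-- The distribution function of `f`, viewed as a function on `(0,∞)` with Lebesgue measure:
`μ_f(s) = λ({t ∈ (0,∞) : f(t) > s})`. -/
def distrib (f : ℝ → ℝ≥0∞) (s : ℝ≥0∞) : ℝ≥0∞ :=
  volume {t : ℝ | t ∈ Set.Ioi (0 : ℝ) ∧ s < f t}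

/-- The non-increasing rearrangement `f*(t) = inf { s ≥ 0 : μ_f(s) ≤ t }`. -/
def rearr (f : ℝ → ℝ≥0∞) (t : ℝ) : ℝ≥0∞ :=
  sInf {s : ℝ≥0∞ | distrib f s ≤ ENNReal.ofReal t}

/-- The operator `R_I f(t) = (1/I(t)) ∫_0^t f(s) ds`. -/
def RI (I : ℝ → ℝ) (f : ℝ → ℝ≥0∞) : ℝ → ℝ≥0∞ :=
  fun t => (∫⁻ s in Set.Ioc (0 : ℝ) t, f s) / ENNReal.ofReal (I t)

/-- The operator `H_I f(t) = ∫_t^∞ f(s)/I(s) ds`. -/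
def HI (I : ℝ → ℝ) (f : ℝ → ℝ≥0∞) : ℝ → ℝ≥0∞ :=
  fun t => ∫⁻ s in Set.Ioi t, f s / ENNReal.ofReal (I s)

/-- `G_I^m f(t) = sup_{s ≥ t} R_I^m f*(s)`. -/
def GI (I : ℝ → ℝ) (m : ℕ) (f : ℝ → ℝ≥0∞) : ℝ → ℝ≥0∞ :=
  fun t => ⨆ s ∈ Set.Ici t, (RI I)^[m] (rearr f) s

/-- `Φ_I^m(t,s) = (∫_s^t 1/I(τ) dτ)^(m-1) / I(t)`. -/
def Phi (I : ℝ → ℝ) (m : ℕ) (t s : ℝ) : ℝ :=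
  (∫ τ in s..t, 1 / I τ) ^ (m - 1) / I t

/-- `Φ_I^m(t,s)` is essentially decreasing in `t`. -/
def EssentiallyDecreasingIn (I : ℝ → ℝ) (m : ℕ) : Prop :=
  ∀ s₀ ∈ Set.Ioi (0 : ℝ), ∃ t₀ ∈ Set.Ioi (0 : ℝ), ∀ t ∈ Set.Ioi t₀,
    ∃ rt ∈ Set.Ioi (0 : ℝ), ∀ r ∈ Set.Ioi rt, ∀ s ∈ Set.Ioo (0 : ℝ) s₀,
      Phi I m r s ≤ Phi I m t s

/-- The kernel operator `f ↦ (t ↦ ∫_t^∞ (f(s)/I(s)) (∫_t^s 1/I(r) dr)^(m-1) ds)`. -/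
def kernelOp (I : ℝ → ℝ) (m : ℕ) (f : ℝ → ℝ≥0∞) : ℝ → ℝ≥0∞ :=
  fun t => ∫⁻ s in Set.Ioi t,
    (f s / ENNReal.ofReal (I s)) * (ENNReal.ofReal (∫ r in t..s, 1 / I r)) ^ (m - 1)

/-- A Banach function norm on (non-negative) measurable functions on `(0,∞)`
(with Lebesgue measure). -/
structure BanachFunctionNorm where
  /-- The norm functional. -/
  N : (ℝ → ℝ≥0∞) → ℝ≥0∞
  /-- Positive homogeneity. -/
  smul : ∀ (c : ℝ≥0) (f : ℝ → ℝ≥0∞), Measurable f →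
    N (fun t => (c : ℝ≥0∞) * f t) = (c : ℝ≥0∞) * N f
  /-- The norm vanishes exactly on a.e.-zero functions. -/
  eq_zero_iff : ∀ f : ℝ → ℝ≥0∞, Measurable f →
    (N f = 0 ↔ ∀ᵐ t ∂(volume.restrict (Set.Ioi (0 : ℝ))), f t = 0)
  /-- Subadditivity. -/
  add_le : ∀ f g : ℝ → ℝ≥0∞, Measurable f → Measurable g →
    N (fun t => f t + g t) ≤ N f + N g
  /-- The lattice property. -/
  mono : ∀ f g : ℝ → ℝ≥0∞, Measurable f → Measurable g →
    (∀ᵐ t ∂(volume.restrict (Set.Ioi (0 : ℝ))), f t ≤ g t) → N f ≤ N g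
  /-- The Fatou property: `f_n ↑ f` a.e. implies `‖f_n‖ ↑ ‖f‖`. -/
  fatou : ∀ (f : ℕ → ℝ → ℝ≥0∞) (g : ℝ → ℝ≥0∞), (∀ n, Measurable (f n)) →
    Measurable g →
    (∀ᵐ t ∂(volume.restrict (Set.Ioi (0 : ℝ))), Monotone fun n => f n t) →
    (∀ᵐ t ∂(volume.restrict (Set.Ioi (0 : ℝ))), g t = ⨆ n, f n t) →
    N g = ⨆ n, N (f n)
  /-- Characteristic functions of sets of finite measure have finite norm. -/
  indicator_lt_top : ∀ E : Set ℝ, MeasurableSet E → E ⊆ Set.Ioi (0 : ℝ) →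
    volume E < ∞ → N (E.indicator 1) < ∞
  /-- Local embedding into `L¹`. -/
  exists_integral_le : ∀ E : Set ℝ, MeasurableSet E → E ⊆ Set.Ioi (0 : ℝ) →
    volume E < ∞ → ∃ C : ℝ≥0∞, C ≠ ∞ ∧
      ∀ f : ℝ → ℝ≥0∞, Measurable f → ∫⁻ t in E, f t ≤ C * N f

/-- A rearrangement-invariant Banach function norm: equimeasurable functions have
equal norms. -/
structure RIBanachFunctionNorm extends BanachFunctionNorm where
  /-- Rearrangement invariance. -/
  ri : ∀ f g : ℝ → ℝ≥0∞, Measurable f → Measurable g →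
    (∀ s, distrib f s = distrib g s) → N f = N g

/-- The associate norm `‖f‖_{X'} = sup { ∫_0^∞ |f g| : ‖g‖_X ≤ 1 }`. -/
def assocNorm (X : RIBanachFunctionNorm) (f : ℝ → ℝ≥0∞) : ℝ≥0∞ :=
  ⨆ (g : ℝ → ℝ≥0∞) (_ : Measurable g) (_ : X.N g ≤ 1),
    ∫⁻ t in Set.Ioi (0 : ℝ), f t * g t

/-- The down-associate norm `‖f‖_{X'_d} = sup { ∫_0^∞ |f| g* : ‖g‖_X ≤ 1 }`. -/
def downAssocNorm (X : RIBanachFunctionNorm) (f : ℝ → ℝ≥0∞) : ℝ≥0∞ :=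
  ⨆ (g : ℝ → ℝ≥0∞) (_ : Measurable g) (_ : X.N g ≤ 1),
    ∫⁻ t in Set.Ioi (0 : ℝ), f t * rearr g t

/-- `f*` is non-increasing. -/
theorem rearr_antitone (f : ℝ → ℝ≥0∞) : Antitone (rearr f) := fun _ _ hst =>
  sInf_le_sInf fun _ hr => le_trans hr (ENNReal.ofReal_le_ofReal hst)

theorem RI_eq_top_iff {I : ℝ → ℝ} {t : ℝ} (hIt : 0 < I t) (g : ℝ → ℝ≥0∞) :
    RI I g t = ∞ ↔ ∫⁻ s in Ioc 0 t, g s = ∞ := by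
  simp [RI, ENNReal.div_eq_top, hIt.not_ge]

/-- An integral over `(0,a]` that is finite stays finite over `(0,b]` if the integrand is bounded
on `(a,b]`. -/
theorem setLIntegral_Ioc_ne_top_of_le {g : ℝ → ℝ≥0∞} {a b : ℝ} {C : ℝ≥0∞} (hC : C ≠ ∞)
    (ha : ∫⁻ s in Ioc 0 a, g s ≠ ∞) (hg : ∀ s ∈ Ioc a b, g s ≤ C) :
    ∫⁻ s in Ioc 0 b, g s ≠ ∞ := by
  have hab : ∫⁻ s in Ioc a b, g s ≤ C * volume (Ioc a b) :=
    (setLIntegral_mono measurable_const hg).trans_eq (setLIntegral_const _ _)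
  have hfin : C * volume (Ioc a b) ≠ ∞ := ENNReal.mul_ne_top hC (by simp)
  refine ne_top_of_le_ne_top (ENNReal.add_ne_top.2 ⟨ha, ne_top_of_le_ne_top hfin hab⟩) ?_
  exact (lintegral_mono_set Ioc_subset_Ioc_union_Ioc).trans (lintegral_union_le _ _ _)

/-- If the integral over `(0,a]` is finite, then the integrand is finite somewhere on `(0,a]`. -/
theorem exists_ne_top_of_setLIntegral_Ioc_ne_top {g : ℝ → ℝ≥0∞} {a : ℝ} (ha0 : 0 < a)
    (ha : ∫⁻ s in Ioc 0 a, g s ≠ ∞) : ∃ s ∈ Ioc 0 a, g s ≠ ∞ := by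
  by_contra! h
  refine ha ?_
  rw [setLIntegral_congr_fun measurableSet_Ioc h, setLIntegral_const]
  simp [ENNReal.top_mul, ha0]

theorem RI_le_div_of_mem_Ioc {I : ℝ → ℝ} (hI : MonotoneOn I (Ioi 0)) (g : ℝ → ℝ≥0∞)
    {a b s : ℝ} (ha0 : 0 < a) (hs : s ∈ Ioc a b) :
    RI I g s ≤ (∫⁻ r in Ioc 0 b, g r) / ENNReal.ofReal (I a) :=
  ENNReal.div_le_div (lintegral_mono_set (Ioc_subset_Ioc_right hs.2))
    (ENNReal.ofReal_le_ofReal (hI ha0 (ha0.trans hs.1) hs.1.le))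

/-- For a non-increasing `u`, if an iterate of `R_I` on `u` is finite somewhere, it is finite
everywhere. -/
theorem iterate_RI_ne_top {I : ℝ → ℝ} (hI : MonotoneOn I (Ioi 0)) (hIpos : ∀ t ∈ Ioi 0, 0 < I t)
    {u : ℝ → ℝ≥0∞} (hu : Antitone u) (n : ℕ) {a : ℝ} (ha0 : 0 < a)
    (ha : (RI I)^[n + 1] u a ≠ ∞) {b : ℝ} (hb0 : 0 < b) : (RI I)^[n + 1] u b ≠ ∞ := by
  induction n generalizing a b with
  | zero =>
    simp only [zero_add, Function.iterate_one, ne_eq, RI_eq_top_iff (hIpos a ha0),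
      RI_eq_top_iff (hIpos b hb0)] at ha ⊢
    obtain ⟨c, hc, hcu⟩ := exists_ne_top_of_setLIntegral_Ioc_ne_top ha0 ha
    exact setLIntegral_Ioc_ne_top_of_le hcu ha fun s hs => hu (hc.2.trans hs.1.le)
  | succ n ih =>
    rw [Function.iterate_succ_apply', ne_eq, RI_eq_top_iff (hIpos _ ‹_›)] at ha ⊢
    obtain ⟨c, hc, hcu⟩ := exists_ne_top_of_setLIntegral_Ioc_ne_top ha0 ha
    have hfin := ih hc.1 hcu hb0
    rw [Function.iterate_succ_apply', ne_eq, RI_eq_top_iff (hIpos b hb0)] at hfin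
    refine setLIntegral_Ioc_ne_top_of_le
      (ENNReal.div_ne_top hfin (ENNReal.ofReal_pos.2 (hIpos a ha0)).ne') ha fun s hs => ?_
    rw [Function.iterate_succ_apply']
    exact RI_le_div_of_mem_Ioc hI _ ha0 hs

/-- if `R_I^m f*` is infinite somewhere, it is infinite everywhere. -/
theorem statement12 (m : ℕ) (hm : 1 ≤ m) (I : ℝ → ℝ)
    (hI : MonotoneOn I (Set.Ioi 0))
    (hIpos : ∀ t ∈ Set.Ioi (0 : ℝ), 0 < I t)
    (f : ℝ → ℝ≥0∞) (hf : Measurable f)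
    (h : ∃ t₀ ∈ Set.Ioi (0 : ℝ), (RI I)^[m] (rearr f) t₀ = ∞) :
    ∀ t ∈ Set.Ioi (0 : ℝ), (RI I)^[m] (rearr f) t = ∞ := by
  obtain ⟨t₀, ht₀, h⟩ := h
  obtain ⟨n, rfl⟩ := Nat.exists_eq_add_of_le' hm
  intro t ht
  by_contra hfin
  exact iterate_RI_ne_top hI hIpos (rearr_antitone f) n ht hfin ht₀ h
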